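/- Let d, D ≥ 2 be integers, let C_4 ∈ ℝ^{24×24} be the associated transfer matrix for k = 4, and for ρ ∈ S_4 let T_ρ ∈ ℝ^{24×24} have entries ⟨τ|T_ρ|θ⟩ = Σ_{σ∈S_4} Wg(στ⁻¹, dD) d^{#(σρ)} D^{#(σθ⁻¹)}. Let v ∈ ℝ^{24} be any row vector with v C_4 = v, let δ_e ∈ ℝ^{24} be the standard basis column vector at the identity permutation e, and let b ≥ 1 be an integer. Then the quantity v T_t^b δ_e is the same for all transpositions t ∈ S_4; in particular v (T_{(12)}^b + T_{(34)}^b − 2 T_{(13)}^b) δ_e = 0. -/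

import Mathlib

open Equiv Matrix

/-- Number of cycles of a permutation, counting fixed points as 1-cycles. -/
noncomputable def cyc {k : ℕ} (π : Equiv.Perm (Fin k)) : ℕ :=
  (k - π.cycleType.sum) + Multiset.card π.cycleType

/-- Gram matrix `G(q)_{στ} = q^{#(στ⁻¹)}`. -/
noncomputable def Gram (k q : ℕ) :
    Matrix (Equiv.Perm (Fin k)) (Equiv.Perm (Fin k)) ℝ :=
  Matrix.of fun σ τ => (q : ℝ) ^ cyc (σ * τ⁻¹)

/-- Weingarten matrix `W = G(q)⁻¹`, so that `Wg(στ⁻¹, q) = W σ τ`. -/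
noncomputable def WgM (k q : ℕ) :
    Matrix (Equiv.Perm (Fin k)) (Equiv.Perm (Fin k)) ℝ :=
  (Gram k q)⁻¹

/-- Transfer matrix `⟨τ|C_k|θ⟩ = Σ_σ Wg(στ⁻¹, dD) d^{#(σ)} D^{#(σθ⁻¹)}`. -/
noncomputable def Ck (k d D : ℕ) :
    Matrix (Equiv.Perm (Fin k)) (Equiv.Perm (Fin k)) ℝ :=
  Matrix.of fun τ θ =>
    ∑ σ : Equiv.Perm (Fin k),
      WgM k (d * D) σ τ * (d : ℝ) ^ cyc σ * (D : ℝ) ^ cyc (σ * θ⁻¹)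

/-- Transfer matrix `⟨τ|T_ρ|θ⟩ = Σ_σ Wg(στ⁻¹, dD) d^{#(σρ)} D^{#(σθ⁻¹)}`. -/
noncomputable def Tmat (k d D : ℕ) (ρ : Equiv.Perm (Fin k)) :
    Matrix (Equiv.Perm (Fin k)) (Equiv.Perm (Fin k)) ℝ :=
  Matrix.of fun τ θ =>
    ∑ σ : Equiv.Perm (Fin k),
      WgM k (d * D) σ τ * (d : ℝ) ^ cyc (σ * ρ) * (D : ℝ) ^ cyc (σ * θ⁻¹)

section CycleCount

variable {k : ℕ}

lemma cyc_conj (g π : Equiv.Perm (Fin k)) : cyc (g * π * g⁻¹) = cyc π := by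
  simp [cyc, Equiv.Perm.cycleType_conj]

lemma cyc_inv (π : Equiv.Perm (Fin k)) : cyc π⁻¹ = cyc π := by
  simp [cyc, Equiv.Perm.cycleType_inv]

lemma cyc_mul_comm (σ τ : Equiv.Perm (Fin k)) : cyc (σ * τ) = cyc (τ * σ) := by
  rw [← cyc_conj τ (σ * τ)]
  congr 1
  group

lemma cyc_mul_inv_comm (σ τ : Equiv.Perm (Fin k)) : cyc (σ * τ⁻¹) = cyc (τ * σ⁻¹) := by
  rw [← cyc_inv, _root_.mul_inv_rev, inv_inv]

lemma cyc_conj_mul_inv_conj (g σ τ : Equiv.Perm (Fin k)) :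
    cyc (MulAut.conj g σ * (MulAut.conj g τ)⁻¹) = cyc (σ * τ⁻¹) := by
  rw [← map_inv, ← map_mul, MulAut.conj_apply, cyc_conj]

lemma cyc_inv_mul_inv_inv (σ τ : Equiv.Perm (Fin k)) :
    cyc (σ⁻¹ * τ⁻¹⁻¹) = cyc (σ * τ⁻¹) := by
  rw [inv_inv, cyc_mul_comm, cyc_mul_inv_comm]

end CycleCount

section Symmetry

variable {k : ℕ}

/-- A bijection of `S_k` preserving `cyc (σ * τ⁻¹)` preserves the Gram matrix, hence the Weingarten
matrix. -/
lemma WgM_submatrix (q : ℕ) (φ : Equiv.Perm (Equiv.Perm (Fin k)))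
    (hφ : ∀ σ τ, cyc (φ σ * (φ τ)⁻¹) = cyc (σ * τ⁻¹)) :
    (WgM k q).submatrix φ φ = WgM k q := by
  rw [WgM, ← Matrix.inv_submatrix_equiv]
  congr 1
  ext σ τ
  simp [Gram, hφ]

lemma Tmat_submatrix (d D : ℕ) (φ : Equiv.Perm (Equiv.Perm (Fin k)))
    (hφ : ∀ σ τ, cyc (φ σ * (φ τ)⁻¹) = cyc (σ * τ⁻¹)) (ρ ρ' : Equiv.Perm (Fin k))
    (hρ : ∀ σ, cyc (φ σ * ρ') = cyc (σ * ρ)) :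
    (Tmat k d D ρ').submatrix φ φ = Tmat k d D ρ := by
  ext τ θ
  simp only [Tmat, Matrix.submatrix_apply, Matrix.of_apply]
  rw [← Equiv.sum_comp φ]
  refine Finset.sum_congr rfl fun σ _ => ?_
  rw [hρ, hφ, ← Matrix.submatrix_apply (WgM k (d * D)) φ φ, WgM_submatrix _ φ hφ]

lemma Ck_eq_Tmat_one (d D : ℕ) : Ck k d D = Tmat k d D 1 := by
  simp [Ck, Tmat]

lemma comp_dotProduct_Tmat_pow (d D b : ℕ) (φ : Equiv.Perm (Equiv.Perm (Fin k)))
    (hφ : ∀ σ τ, cyc (φ σ * (φ τ)⁻¹) = cyc (σ * τ⁻¹)) (hφ_one : φ 1 = 1)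
    (ρ ρ' : Equiv.Perm (Fin k)) (hρ : ∀ σ, cyc (φ σ * ρ') = cyc (σ * ρ))
    (v : Equiv.Perm (Fin k) → ℝ) :
    (v ∘ φ) ⬝ᵥ ((Tmat k d D ρ) ^ b).mulVec (Pi.single 1 1) =
      v ⬝ᵥ ((Tmat k d D ρ') ^ b).mulVec (Pi.single 1 1) := by
  have hpow : Tmat k d D ρ ^ b = (Tmat k d D ρ' ^ b).submatrix φ φ := by
    rw [← Tmat_submatrix d D φ hφ ρ ρ' hρ]
    exact (map_pow (Matrix.reindexAlgEquiv ℝ ℝ φ.symm) (Tmat k d D ρ') b).symm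
  rw [hpow, Matrix.mulVec_single_one, Matrix.mulVec_single_one]
  simp only [dotProduct, Matrix.col_apply, Matrix.submatrix_apply, hφ_one, Function.comp_apply]
  exact Equiv.sum_comp φ fun σ => v σ * (Tmat k d D ρ' ^ b) σ 1

lemma comp_vecMul_Ck (d D : ℕ) (φ : Equiv.Perm (Equiv.Perm (Fin k)))
    (hφ : ∀ σ τ, cyc (φ σ * (φ τ)⁻¹) = cyc (σ * τ⁻¹)) (hcyc : ∀ σ, cyc (φ σ) = cyc σ)
    {v : Equiv.Perm (Fin k) → ℝ} (hv : v ᵥ* Ck k d D = v) :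
    (v ∘ φ) ᵥ* Ck k d D = v ∘ φ := by
  have hC : (Ck k d D).submatrix φ φ = Ck k d D := by
    rw [Ck_eq_Tmat_one]
    exact Tmat_submatrix d D φ hφ 1 1 (by simpa using hcyc)
  rw [← hC, Matrix.submatrix_vecMul_equiv]
  simp [Function.comp_assoc, hv]

end Symmetry

section Kernel

variable {k : ℕ}

/-- The equations `u · diag(d^{#σ}) · G(D) = u · G(dD)` satisfied by `u = Wg · v` when `v` is a left
fixed vector of the transfer matrix. -/
def IsGramBalanced (d D : ℕ) (u : Equiv.Perm (Fin k) → ℝ) : Prop :=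
  ∀ θ, ∑ σ, u σ * ((d : ℝ) ^ cyc σ * (D : ℝ) ^ cyc (σ * θ⁻¹)
    - ((d * D : ℕ) : ℝ) ^ cyc (σ * θ⁻¹)) = 0

lemma Gram_mulVec_WgM_mulVec (d D : ℕ) {v : Equiv.Perm (Fin k) → ℝ}
    (hv : v ᵥ* Ck k d D = v) :
    Gram k (d * D) *ᵥ (WgM k (d * D) *ᵥ v) = v := by
  by_cases hG : IsUnit (Gram k (d * D)).det
  · rw [Matrix.mulVec_mulVec, WgM, Matrix.mul_nonsing_inv _ hG, Matrix.one_mulVec]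
  · have hW : WgM k (d * D) = 0 := Matrix.nonsing_inv_apply_not_isUnit _ hG
    have hC : Ck k d D = 0 := by
      ext τ θ
      simp [Ck, hW]
    have hv_zero : v = 0 := by rw [← hv, hC, Matrix.vecMul_zero]
    simp [hv_zero]

lemma isGramBalanced_WgM_mulVec (d D : ℕ) {v : Equiv.Perm (Fin k) → ℝ}
    (hv : v ᵥ* Ck k d D = v) : IsGramBalanced d D (WgM k (d * D) *ᵥ v) := by
  intro θ
  have hfix : v θ = ∑ σ, (WgM k (d * D) *ᵥ v) σ *
      ((d : ℝ) ^ cyc σ * (D : ℝ) ^ cyc (σ * θ⁻¹)) := by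
    conv_lhs => rw [← hv]
    simp only [Matrix.vecMul, Matrix.mulVec, dotProduct, Ck, Matrix.of_apply, Finset.mul_sum,
      Finset.sum_mul]
    rw [Finset.sum_comm]
    refine Finset.sum_congr rfl fun σ _ => Finset.sum_congr rfl fun τ _ => ?_
    ring
  have hgram : v θ = ∑ σ, (WgM k (d * D) *ᵥ v) σ * ((d * D : ℕ) : ℝ) ^ cyc (σ * θ⁻¹) := by
    conv_lhs => rw [← Gram_mulVec_WgM_mulVec d D hv, Matrix.mulVec, dotProduct]
    refine Finset.sum_congr rfl fun σ _ => ?_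
    rw [Gram, Matrix.of_apply, cyc_mul_inv_comm, mul_comm]
  simp only [mul_sub, Finset.sum_sub_distrib, ← hfix, ← hgram, sub_self]

lemma IsGramBalanced.comp {d D : ℕ} {u : Equiv.Perm (Fin k) → ℝ} (hu : IsGramBalanced d D u)
    (φ : Equiv.Perm (Equiv.Perm (Fin k)))
    (hφ : ∀ σ τ, cyc (φ σ * (φ τ)⁻¹) = cyc (σ * τ⁻¹)) (hcyc : ∀ σ, cyc (φ σ) = cyc σ) :
    IsGramBalanced d D (u ∘ φ) := by
  intro θ
  have h := hu (φ θ)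
  rw [← Equiv.sum_comp φ] at h
  simpa only [hφ, hcyc, Function.comp_apply] using h

end Kernel

section SymmetricGroupFour

/-- A computable form of `cyc` on `S₄`. -/
def cycFour (π : Equiv.Perm (Fin 4)) : ℕ :=
  if π = 1 then 4
  else if π * π = 1 then (if ∃ i, π i = i then 3 else 2)
  else if ∃ i, π i = i then 2 else 1

lemma cyc_eq_cycFour (π : Equiv.Perm (Fin 4)) : cyc π = cycFour π := by
  have hconj : [1, swap 0 1, swap 0 1 * swap 2 3, swap 0 1 * swap 0 2,
      swap 0 1 * swap 1 2 * swap 2 3].any fun r => cycFour π = cycFour r ∧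
        ∃ g : Equiv.Perm (Fin 4), g * r = π * g := by
    revert π
    decide +kernel
  simp only [List.any_eq_true, decide_eq_true_eq] at hconj
  obtain ⟨r, hr, hcyc, g, hg⟩ := hconj
  obtain rfl : g * r * g⁻¹ = π := mul_inv_eq_of_eq_mul hg
  simp only [List.mem_cons, List.not_mem_nil, or_false] at hr
  rw [hcyc, cyc_conj]
  have hswap {i j : Fin 4} (hij : i ≠ j) : (swap i j).cycleType = {2} := by
    rw [(Equiv.Perm.isCycle_swap hij).cycleType, Equiv.Perm.card_support_swap hij]
  rcases hr with rfl | rfl | rfl | rfl | rfl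
  · simp [cyc, cycFour]
  · rw [cyc, hswap (by decide)]
    decide
  · have hdisj : Equiv.Perm.Disjoint (swap (0 : Fin 4) 1) (swap 2 3) := by
      unfold Equiv.Perm.Disjoint
      decide
    rw [cyc, hdisj.cycleType_mul, hswap (by decide), hswap (by decide)]
    decide
  · have h : (swap (0 : Fin 4) 1 * swap 0 2).IsThreeCycle :=
      Equiv.Perm.isThreeCycle_swap_mul_swap_same (by decide) (by decide) (by decide)
    rw [cyc, h.cycleType]
    decide
  · have h : swap (0 : Fin 4) 1 * swap 1 2 * swap 2 3 = finRotate 4 := by decide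
    rw [cyc, h, cycleType_finRotate, ← h]
    decide

/-- The signed indicator of two lists of permutations, counted with multiplicity. -/
def countDiff (s t : List (Equiv.Perm (Fin 4))) (σ : Equiv.Perm (Fin 4)) : ℤ :=
  (s.count σ : ℤ) - t.count σ

lemma sum_mul_count (u : Equiv.Perm (Fin 4) → ℝ) (s : List (Equiv.Perm (Fin 4))) :
    ∑ σ, u σ * (s.count σ : ℝ) = (s.map u).sum := by
  induction s with
  | nil => simp
  | cons a s ih =>
    simp [List.count_cons, mul_add, Finset.sum_add_distrib, ih, add_comm]

lemma sum_mul_countDiff (u : Equiv.Perm (Fin 4) → ℝ) (s t : List (Equiv.Perm (Fin 4))) :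
    ∑ σ, u σ * (countDiff s t σ : ℝ) = (s.map u).sum - (t.map u).sum := by
  simp only [countDiff, Int.cast_sub, Int.cast_natCast, mul_sub, Finset.sum_sub_distrib,
    sum_mul_count]

lemma sum_map_pow_cyc (s : List (Equiv.Perm (Fin 4))) (q : ℝ) (σ : Equiv.Perm (Fin 4)) :
    (s.map fun θ => q ^ cyc (σ * θ⁻¹)).sum =
      ∑ m : Fin 5, (s.countP fun θ => cycFour (σ * θ⁻¹) = m : ℝ) * q ^ (m : ℕ) := by
  induction s with
  | nil => simp
  | cons θ s ih =>
    have hlt : cycFour (σ * θ⁻¹) < 5 := by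
      unfold cycFour
      split_ifs <;> norm_num
    have hsingle : ∑ m : Fin 5, (if cycFour (σ * θ⁻¹) = m then 1 else 0 : ℝ) * q ^ (m : ℕ) =
        q ^ cyc (σ * θ⁻¹) := by
      rw [Finset.sum_eq_single (⟨cycFour (σ * θ⁻¹), hlt⟩ : Fin 5)]
      · simp [cyc_eq_cycFour]
      · intro m _ hm
        have : cycFour (σ * θ⁻¹) ≠ m := fun h => hm (Fin.ext h.symm)
        simp [this]
      · simp
    rw [List.map_cons, List.sum_cons, ih, ← hsingle, ← Finset.sum_add_distrib]
    refine Finset.sum_congr rfl fun m _ => ?_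
    rw [List.countP_cons]
    push_cast
    simp only [decide_eq_true_eq]
    ring

/-- Pairing the balance equations with one of the vectors `countDiff (S l) (T l)`, each supported on
permutations with `c l` cycles, whose span contains the convolutions of the chosen vector with the
cycle-count level sets. -/
lemma IsGramBalanced.sum_block {n d D : ℕ} {u : Equiv.Perm (Fin 4) → ℝ}
    (hu : IsGramBalanced d D u) (S T : Fin n → List (Equiv.Perm (Fin 4))) (c : Fin n → ℕ)
    (hc : ∀ l, (S l ++ T l).all fun σ => cycFour σ = c l) (j : Fin n) (P : Fin n → Fin 5 → ℤ)
    (hP : ∀ σ, ∀ m : Fin 5,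
      ((S j).countP fun θ => cycFour (σ * θ⁻¹) = m : ℤ)
        - ((T j).countP fun θ => cycFour (σ * θ⁻¹) = m : ℤ)
        = ∑ l, P l m * countDiff (S l) (T l) σ) :
    ∑ l, (∑ m : Fin 5, (P l m : ℝ) * ((d : ℝ) ^ c l * (D : ℝ) ^ (m : ℕ)
      - ((d : ℝ) * D) ^ (m : ℕ))) * (((S l).map u).sum - ((T l).map u).sum) = 0 := by
  set f := countDiff (S j) (T j) with hf
  let g (l : Fin n) := countDiff (S l) (T l)
  have hgram (q : ℝ) (σ) : ∑ θ, (f θ : ℝ) * q ^ cyc (σ * θ⁻¹) =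
      ∑ l, (∑ m : Fin 5, (P l m : ℝ) * q ^ (m : ℕ)) * g l σ := by
    rw [Finset.sum_congr rfl fun θ _ => mul_comm (f θ : ℝ) (q ^ cyc (σ * θ⁻¹)), hf,
      sum_mul_countDiff (fun θ => q ^ cyc (σ * θ⁻¹))]
    simp only [sum_map_pow_cyc, Finset.sum_mul]
    rw [← Finset.sum_sub_distrib, Finset.sum_comm]
    refine Finset.sum_congr rfl fun m _ => ?_
    have h : (((S j).countP fun θ => cycFour (σ * θ⁻¹) = m : ℝ)
        - ((T j).countP fun θ => cycFour (σ * θ⁻¹) = m : ℝ)) = ∑ l, (P l m : ℝ) * g l σ := by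
      exact_mod_cast hP σ m
    rw [← sub_mul, h, Finset.sum_mul]
    refine Finset.sum_congr rfl fun l _ => ?_
    ring
  have hpow (l : Fin n) (σ) : (d : ℝ) ^ cyc σ * g l σ = (d : ℝ) ^ c l * g l σ := by
    by_cases h : σ ∈ S l ++ T l
    · rw [cyc_eq_cycFour, of_decide_eq_true (List.all_eq_true.mp (hc l) σ h)]
    · rw [List.mem_append, not_or] at h
      simp [g, countDiff, List.count_eq_zero_of_not_mem h.1, List.count_eq_zero_of_not_mem h.2]
  have hpair : ∑ θ, (f θ : ℝ) * ∑ σ, u σ * ((d : ℝ) ^ cyc σ * (D : ℝ) ^ cyc (σ * θ⁻¹)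
      - ((d * D : ℕ) : ℝ) ^ cyc (σ * θ⁻¹)) = 0 := by
    simp only [hu _, mul_zero, Finset.sum_const_zero]
  simp only [← sum_mul_countDiff]
  rw [← hpair]
  simp only [Finset.mul_sum]
  rw [Finset.sum_comm, Finset.sum_comm (s := (Finset.univ : Finset (Equiv.Perm (Fin 4))))
    (t := (Finset.univ : Finset (Equiv.Perm (Fin 4))))]
  refine Finset.sum_congr rfl fun σ _ => ?_
  have hθ : ∑ θ, (f θ : ℝ) * (u σ * ((d : ℝ) ^ cyc σ * (D : ℝ) ^ cyc (σ * θ⁻¹)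
      - ((d * D : ℕ) : ℝ) ^ cyc (σ * θ⁻¹))) =
      u σ * ((d : ℝ) ^ cyc σ * (∑ θ, (f θ : ℝ) * (D : ℝ) ^ cyc (σ * θ⁻¹))
        - ∑ θ, (f θ : ℝ) * ((d : ℝ) * D) ^ cyc (σ * θ⁻¹)) := by
    rw [Finset.mul_sum, ← Finset.sum_sub_distrib, Finset.mul_sum]
    refine Finset.sum_congr rfl fun θ _ => ?_
    push_cast
    ring
  rw [hθ, hgram, hgram, Finset.mul_sum, ← Finset.sum_sub_distrib, Finset.mul_sum]
  refine Finset.sum_congr rfl fun l _ => ?_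
  simp only [mul_sub, Finset.sum_sub_distrib]
  have hfac : ∑ m : Fin 5, (P l m : ℝ) * ((d : ℝ) ^ c l * (D : ℝ) ^ (m : ℕ)) =
      (d : ℝ) ^ c l * ∑ m : Fin 5, (P l m : ℝ) * (D : ℝ) ^ (m : ℕ) := by
    rw [Finset.mul_sum]
    refine Finset.sum_congr rfl fun m _ => ?_
    ring
  rw [hfac]
  linear_combination -(u σ * ∑ m : Fin 5, (P l m : ℝ) * (D : ℝ) ^ (m : ℕ)) * hpow l σ

lemma standard_system {a b x y : ℝ} (ha : 2 ≤ a) (hb : 2 ≤ b)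
    (h₁ : (a * b * (a - 1) * (a * b ^ 2 + 1)) * (2 * y - a * b * x) = 0)
    (h₂ : (a * b * (a ^ 2 - 1)) * (2 * x - a * b ^ 3 * y) = 0) : x = 0 ∧ y = 0 := by
  have ha₁ : 0 < a - 1 := by linarith
  have ha₂ : 0 < a ^ 2 - 1 := by nlinarith
  have hb₀ : 0 < b := by linarith
  have ha₀ : 0 < a := by linarith
  replace h₁ := (mul_eq_zero.mp h₁).resolve_left (by positivity)
  replace h₂ := (mul_eq_zero.mp h₂).resolve_left (by positivity)
  have hab : 2 * 2 ^ 2 ≤ a * b ^ 2 := by gcongr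
  have hx : ((a * b ^ 2) ^ 2 - 4) * x = 0 := by
    linear_combination -2 * h₂ - a * b ^ 3 * h₁
  have hx₀ : x = 0 := (mul_eq_zero.mp hx).resolve_left (by nlinarith)
  subst hx₀
  exact ⟨rfl, by linarith⟩

lemma two_two_system {a b x y z : ℝ} (ha : 2 ≤ a) (hb : 2 ≤ b)
    (h₁ : (a * b * (a - 1) * (a * b ^ 2 + 1)) * -(a * b * x + 2 * y) = 0)
    (h₂ : (a * b * (a ^ 2 - 1)) * (-x - a * b ^ 3 * y + b ^ 2 * z) = 0)
    (h₃ : (a * b * (a - 1)) *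
      (2 * (a * b ^ 2 + 1) * y - b * (b ^ 2 * (a ^ 2 + a + 1) - 1) * z) = 0) :
    x = 0 ∧ y = 0 ∧ z = 0 := by
  have ha₁ : 0 < a - 1 := by linarith
  have ha₂ : 0 < a ^ 2 - 1 := by nlinarith
  have hb₀ : 0 < b := by linarith
  have ha₀ : 0 < a := by linarith
  replace h₁ := (mul_eq_zero.mp h₁).resolve_left (by positivity)
  replace h₂ := (mul_eq_zero.mp h₂).resolve_left (by positivity)
  replace h₃ := (mul_eq_zero.mp h₃).resolve_left (by positivity)
  have hab : 2 * 2 ^ 2 ≤ a * b ^ 2 := by gcongr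
  have hK : 2 * (a * b ^ 2) ≤ b ^ 2 * (a ^ 2 + a + 1) - 1 := by nlinarith
  have hy : (((a * b ^ 2) ^ 2 - 2) * (b ^ 2 * (a ^ 2 + a + 1) - 1)
      - 2 * (a * b ^ 2) * (a * b ^ 2 + 1)) * y = 0 := by
    linear_combination (b ^ 2 * (a ^ 2 + a + 1) - 1) * (h₁ - a * b * h₂) - a * b ^ 2 * h₃
  have hpos : 0 < ((a * b ^ 2) ^ 2 - 2) * (b ^ 2 * (a ^ 2 + a + 1) - 1)
      - 2 * (a * b ^ 2) * (a * b ^ 2 + 1) := by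
    have := mul_le_mul_of_nonneg_left hK (by nlinarith : 0 ≤ (a * b ^ 2) ^ 2 - 2)
    have : 0 < 2 * (a * b ^ 2) * ((a * b ^ 2) ^ 2 - 2 - (a * b ^ 2 + 1)) :=
      mul_pos (by positivity) (by nlinarith)
    linarith
  have hy₀ : y = 0 := (mul_eq_zero.mp hy).resolve_left hpos.ne'
  subst hy₀
  have hx₀ : x = 0 := by
    refine (mul_eq_zero.mp (?_ : (a * b) * x = 0)).resolve_left (by positivity)
    linarith
  subst hx₀
  refine ⟨rfl, rfl, (mul_eq_zero.mp (?_ : b ^ 2 * z = 0)).resolve_left (by positivity)⟩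
  linarith

/-- The block of the irreducible representation `(3,1)`. -/
lemma IsGramBalanced.standard_block {d D : ℕ} (hd : 2 ≤ d) (hD : 2 ≤ D)
    {u : Equiv.Perm (Fin 4) → ℝ} (hu : IsGramBalanced d D u) :
    u (swap 0 2) + u (swap 0 3) - (u (swap 1 2) + u (swap 1 3)) = 0 ∧
    u (swap 1 2 * swap 2 3) + u (swap 2 3 * swap 1 2)
      - (u (swap 0 2 * swap 2 3) + u (swap 2 3 * swap 0 2)) = 0 := by
  have block := hu.sum_block
    ![[swap 0 2, swap 0 3], [swap 1 2 * swap 2 3, swap 2 3 * swap 1 2]]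
    ![[swap 1 2, swap 1 3], [swap 0 2 * swap 2 3, swap 2 3 * swap 0 2]]
    ![3, 2] (by decide +kernel)
  have h₁ := block 0 ![![0, 0, -1, 0, 1], ![0, 2, 0, -2, 0]] (by decide +kernel)
  have h₂ := block 1 ![![0, 2, 0, -2, 0], ![0, 0, -1, 0, 1]] (by decide +kernel)
  simp [Fin.sum_univ_succ] at h₁ h₂
  exact standard_system (a := d) (b := D) (by exact_mod_cast hd) (by exact_mod_cast hD)
    (by linear_combination h₁) (by linear_combination h₂)

/-- The block of the irreducible representation `(2,2)`. -/
lemma IsGramBalanced.two_two_block {d D : ℕ} (hd : 2 ≤ d) (hD : 2 ≤ D)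
    {u : Equiv.Perm (Fin 4) → ℝ} (hu : IsGramBalanced d D u) :
    u (swap 0 2) + u (swap 1 3) - (u (swap 0 3) + u (swap 1 2)) = 0 ∧
    u (swap 0 2 * swap 1 3) - u (swap 0 3 * swap 1 2) = 0 ∧
    u (swap 0 1 * swap 1 2 * swap 2 3) + u (swap 2 3 * swap 1 2 * swap 0 1)
      - (u (swap 1 2 * swap 2 3 * swap 0 1) + u (swap 0 1 * swap 2 3 * swap 1 2)) = 0 := by
  have block := hu.sum_block
    ![[swap 0 2, swap 1 3], [swap 0 2 * swap 1 3],
      [swap 0 1 * swap 1 2 * swap 2 3, swap 2 3 * swap 1 2 * swap 0 1]]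
    ![[swap 0 3, swap 1 2], [swap 0 3 * swap 1 2],
      [swap 1 2 * swap 2 3 * swap 0 1, swap 0 1 * swap 2 3 * swap 1 2]]
    ![3, 2, 1] (by decide +kernel)
  have h₁ := block 0 ![![0, 0, -1, 0, 1], ![0, -2, 0, 2, 0], 0] (by decide +kernel)
  have h₂ := block 1 ![![0, -1, 0, 1, 0], ![0, 0, -1, 0, 1], ![0, 1, 0, -1, 0]]
    (by decide +kernel)
  have h₃ := block 2 ![0, ![0, 2, 0, -2, 0], ![0, 0, -1, 0, 1]] (by decide +kernel)
  simp [Fin.sum_univ_succ] at h₁ h₂ h₃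
  exact two_two_system (a := d) (b := D) (by exact_mod_cast hd) (by exact_mod_cast hD)
    (by linear_combination h₁) (by linear_combination h₂) (by linear_combination h₃)

lemma IsGramBalanced.apply_swap_conj {d D : ℕ} (hd : 2 ≤ d) (hD : 2 ≤ D)
    {u : Equiv.Perm (Fin 4) → ℝ} (hu : IsGramBalanced d D u) (hinv : ∀ σ, u σ⁻¹ = u σ)
    (σ : Equiv.Perm (Fin 4)) : u (swap 0 1 * σ * swap 0 1) = u σ := by
  have hstep {τ : Equiv.Perm (Fin 4)} (h : u (swap 0 1 * τ * swap 0 1) = u τ) :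
      u (swap 0 1 * τ⁻¹ * swap 0 1) = u τ⁻¹ := by
    rw [hinv, ← h, ← hinv]
    congr 1
  have hcases : ∀ σ : Equiv.Perm (Fin 4), swap 0 1 * σ * swap 0 1 = σ ∨
      swap 0 1 * σ * swap 0 1 = σ⁻¹ ∨
      [swap 0 2, swap 0 3, swap 0 2 * swap 1 3, swap 1 2 * swap 2 3,
          swap 0 1 * swap 1 2 * swap 2 3].any fun τ =>
        σ = τ ∨ σ = τ⁻¹ ∨ σ = swap 0 1 * τ * swap 0 1 ∨ σ = swap 0 1 * τ⁻¹ * swap 0 1 := by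
    decide +kernel
  obtain ⟨hx, hy⟩ := hu.standard_block hd hD
  obtain ⟨hx', hy', hz'⟩ := hu.two_two_block hd hD
  simp only [List.any_eq_true, decide_eq_true_eq] at hcases
  rcases hcases σ with h | h | ⟨τ, hτ, h⟩
  · rw [h]
  · rw [h, hinv]
  have hτ' : u (swap 0 1 * τ * swap 0 1) = u τ := by
    simp only [List.mem_cons, List.not_mem_nil, or_false] at hτ
    rcases hτ with rfl | rfl | rfl | rfl | rfl
    · rw [show swap (0 : Fin 4) 1 * swap 0 2 * swap 0 1 = swap 1 2 by decide]
      linarith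
    · rw [show swap (0 : Fin 4) 1 * swap 0 3 * swap 0 1 = swap 1 3 by decide]
      linarith
    · rw [show swap (0 : Fin 4) 1 * (swap 0 2 * swap 1 3) * swap 0 1 = swap 0 3 * swap 1 2 by
        decide]
      linarith
    · have h₁ := hinv (swap 1 2 * swap 2 3)
      have h₂ := hinv (swap 0 2 * swap 2 3)
      simp only [_root_.mul_inv_rev, Equiv.swap_inv] at h₁ h₂
      rw [show swap (0 : Fin 4) 1 * (swap 1 2 * swap 2 3) * swap 0 1 = swap 0 2 * swap 2 3 by
        decide]
      linarith
    · have h₁ := hinv (swap 0 1 * swap 1 2 * swap 2 3)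
      have h₂ := hinv (swap 1 2 * swap 2 3 * swap 0 1)
      simp only [_root_.mul_inv_rev, Equiv.swap_inv, ← mul_assoc] at h₁ h₂
      rw [show swap (0 : Fin 4) 1 * (swap 0 1 * swap 1 2 * swap 2 3) * swap 0 1 =
        swap 1 2 * swap 2 3 * swap 0 1 by decide]
      linarith
  have hdouble (τ : Equiv.Perm (Fin 4)) :
      swap 0 1 * (swap 0 1 * τ * swap 0 1) * swap 0 1 = τ := by
    simp [mul_assoc]
  rcases h with rfl | rfl | rfl | rfl
  · exact hτ'
  · exact hstep hτ'
  · rw [hdouble, hτ']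
  · rw [hdouble, hstep hτ']

lemma IsGramBalanced.apply_conj {d D : ℕ} (hd : 2 ≤ d) (hD : 2 ≤ D)
    {u : Equiv.Perm (Fin 4) → ℝ} (hu : IsGramBalanced d D u) (hinv : ∀ σ, u σ⁻¹ = u σ)
    (g σ : Equiv.Perm (Fin 4)) : u (g * σ * g⁻¹) = u σ := by
  induction g using Equiv.Perm.swap_induction_on generalizing σ with
  | one => simp
  | swap_mul g i j hij ih =>
    obtain ⟨c, hc⟩ := isConj_iff.mp
      (Equiv.Perm.isConj_swap (show (0 : Fin 4) ≠ 1 by decide) hij)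
    have h := (hu.comp (MulAut.conj c).toEquiv (cyc_conj_mul_inv_conj c)
      (cyc_conj c)).apply_swap_conj hd hD
      (fun τ => by simpa [mul_assoc] using hinv (c * τ * c⁻¹))
      (c⁻¹ * (g * σ * g⁻¹) * c)
    rw [← ih σ, ← hc]
    simpa [mul_assoc] using h

end SymmetricGroupFour

/-- A left fixed vector of `C₄` that is invariant under inversion is a class function. -/
lemma apply_conj_of_vecMul_Ck {d D : ℕ} (hd : 2 ≤ d) (hD : 2 ≤ D)
    {v : Equiv.Perm (Fin 4) → ℝ} (hv : v ᵥ* Ck 4 d D = v) (hinv : ∀ σ, v σ⁻¹ = v σ)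
    (g σ : Equiv.Perm (Fin 4)) : v (g * σ * g⁻¹) = v σ := by
  set u := WgM 4 (d * D) *ᵥ v with hu
  have hu_inv (σ) : u σ⁻¹ = u σ := by
    have hW := WgM_submatrix (d * D) (Equiv.inv (Equiv.Perm (Fin 4))) cyc_inv_mul_inv_inv
    simp only [hu, Matrix.mulVec, dotProduct]
    rw [← Equiv.sum_comp (Equiv.inv (Equiv.Perm (Fin 4)))]
    refine Finset.sum_congr rfl fun τ _ => ?_
    rw [Equiv.inv_apply, hinv]
    exact congrArg (· * v τ) (congrFun (congrFun hW σ) τ)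
  have hu_conj := (isGramBalanced_WgM_mulVec d D hv).apply_conj hd hD hu_inv g
  rw [← Gram_mulVec_WgM_mulVec d D hv]
  simp only [Matrix.mulVec, dotProduct, Gram, Matrix.of_apply]
  rw [← Equiv.sum_comp (MulAut.conj g).toEquiv]
  refine Finset.sum_congr rfl fun τ _ => ?_
  have hcyc : cyc (g * σ * g⁻¹ * (g * τ * g⁻¹)⁻¹) = cyc (σ * τ⁻¹) :=
    cyc_conj_mul_inv_conj g σ τ
  have hτ := hu_conj τ
  simp only [Matrix.mulVec, dotProduct] at hτ
  simp only [MulEquiv.toEquiv_eq_coe, EquivLike.coe_coe, MulAut.conj_apply, hcyc, hτ]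

/-- For any left fixed (row) vector `v` of `C₄` and any `b ≥ 1`, the quantity
`v T_t^b δ_e` is the same for every transposition `t ∈ S₄`; in particular
`v (T_{(12)}^b + T_{(34)}^b − 2 T_{(13)}^b) δ_e = 0`. -/
theorem left_fixed_vector_transposition_indep (d D : ℕ) (hd : 2 ≤ d) (hD : 2 ≤ D)
    (b : ℕ) (hb : 1 ≤ b) (v : Equiv.Perm (Fin 4) → ℝ) (hv : v ᵥ* Ck 4 d D = v) :
    (∀ t t' : Equiv.Perm (Fin 4), t.IsSwap → t'.IsSwap →
      v ⬝ᵥ ((Tmat 4 d D t) ^ b).mulVec (Pi.single (1 : Equiv.Perm (Fin 4)) (1 : ℝ)) =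
      v ⬝ᵥ ((Tmat 4 d D t') ^ b).mulVec (Pi.single (1 : Equiv.Perm (Fin 4)) (1 : ℝ))) ∧
    v ⬝ᵥ ((Tmat 4 d D (Equiv.swap (0 : Fin 4) 1)) ^ b
        + (Tmat 4 d D (Equiv.swap (2 : Fin 4) 3)) ^ b
        - (2 : ℝ) • (Tmat 4 d D (Equiv.swap (0 : Fin 4) 2)) ^ b).mulVec
        (Pi.single (1 : Equiv.Perm (Fin 4)) (1 : ℝ)) = 0 := by
  have main : ∀ t t' : Equiv.Perm (Fin 4), t.IsSwap → t'.IsSwap →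
      v ⬝ᵥ ((Tmat 4 d D t) ^ b).mulVec (Pi.single (1 : Equiv.Perm (Fin 4)) (1 : ℝ)) =
      v ⬝ᵥ ((Tmat 4 d D t') ^ b).mulVec (Pi.single (1 : Equiv.Perm (Fin 4)) (1 : ℝ)) := by
    intro t t' ht ht'
    let ι := Equiv.inv (Equiv.Perm (Fin 4))
    have hsymm {s : Equiv.Perm (Fin 4)} (hs : s.IsSwap) :
        (v + v ∘ ι) ⬝ᵥ ((Tmat 4 d D s) ^ b).mulVec (Pi.single 1 1) =
          2 * (v ⬝ᵥ ((Tmat 4 d D s) ^ b).mulVec (Pi.single 1 1)) := by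
      obtain ⟨i, j, _, rfl⟩ := hs
      rw [add_dotProduct, comp_dotProduct_Tmat_pow d D b ι cyc_inv_mul_inv_inv inv_one
        (swap i j) (swap i j), two_mul]
      intro σ
      rw [cyc_mul_comm σ, ← cyc_inv (swap i j * σ), _root_.mul_inv_rev, Equiv.swap_inv]
      rfl
    have hfix : (v + v ∘ ι) ᵥ* Ck 4 d D = v + v ∘ ι := by
      rw [Matrix.add_vecMul, hv, comp_vecMul_Ck d D ι cyc_inv_mul_inv_inv cyc_inv hv]
    have hclass := apply_conj_of_vecMul_Ck hd hD hfix
      (fun σ => by simp [ι, add_comm])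
    have hconj : IsConj t t' := by
      obtain ⟨i, j, hij, rfl⟩ := ht
      obtain ⟨i', j', hij', rfl⟩ := ht'
      exact Equiv.Perm.isConj_swap hij hij'
    obtain ⟨g, hg⟩ := isConj_iff.mp hconj
    have hmove := comp_dotProduct_Tmat_pow d D b (MulAut.conj g).toEquiv
      (cyc_conj_mul_inv_conj g) (map_one (MulAut.conj g)) t t'
      (fun σ => by
        rw [← cyc_conj g (σ * t), ← hg]
        congr 1
        simp [mul_assoc])
      (v + v ∘ ι)
    have hcomp : (v + v ∘ ι) ∘ (MulAut.conj g).toEquiv = v + v ∘ ι := funext (hclass g)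
    rw [hcomp, hsymm ht, hsymm ht'] at hmove
    linarith
  refine ⟨main, ?_⟩
  have h₁ := main (swap 0 1) (swap 0 2) ⟨0, 1, by decide, rfl⟩ ⟨0, 2, by decide, rfl⟩
  have h₂ := main (swap 2 3) (swap 0 2) ⟨2, 3, by decide, rfl⟩ ⟨0, 2, by decide, rfl⟩
  rw [Matrix.sub_mulVec, Matrix.add_mulVec, Matrix.smul_mulVec, dotProduct_sub, dotProduct_add,
    dotProduct_smul, smul_eq_mul, h₁, h₂]
  ring
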